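/- Let A be a dg-algebra over a field k with differential d and product written by juxtaposition, and let n ≥ 3. Suppose given multilinear maps m_k : H_*(A)^{⊗k} → H_*(A) of degree 2−k for 1 ≤ k ≤ n−1 with m_1 = 0 and m_2 the induced multiplication, and multilinear maps f_k : H_*(A)^{⊗k} → A of degree 1−k for 1 ≤ k ≤ n−1 with f_1 cycle-choosing, such that the Stasheff identities St_k hold on H_*(A) and the Stasheff morphism identities St^m_k hold for all k ≤ n−1. Then for all homogeneous a_1,…,a_n ∈ H_*(A), the element Ψ_n(a_1,…,a_n) ∈ A is a cycle: d(Ψ_n(a_1,…,a_n)) = 0. -/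

import Mathlib

/-!
Cycle-level encoding of `A_∞`-structures on the homology of a differential graded
algebra, following Kadeishvili.

A dg-algebra is presented as a `k`-algebra `A` with a grading `𝒜 : ℤ → Submodule k A`
(a graded monoid giving a direct sum decomposition) and a degree `+1` square-zero
differential `d` satisfying the graded Leibniz rule.

Elements of the homology `H = ker d / im d` are encoded by representing cycles.
A family of multilinear maps `(g_n : H^{⊗n} → A)_n` (resp. with values in `H`) is
encoded by a single function `F : List A → A` (the arity being the list length),
evaluated on lists of representing cycles; that `F` genuinely comes from a family
of multilinear maps on homology is expressed by the predicates below.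
-/

open LinearMap

/-- The integer sign `(-1) ^ e` associated to an integer exponent `e`. -/
def gsign (e : ℤ) : ℤ := if Even e then 1 else -1

variable {k A : Type*} [Field k] [Ring A] [Algebra k A]

/-- `(𝒜, d)` make the `k`-algebra `A` into a differential graded algebra. -/
structure IsDGAlgebra (𝒜 : ℤ → Submodule k A) (d : A →ₗ[k] A) : Prop where
  d_sq : ∀ x : A, d (d x) = 0
  d_deg : ∀ (i : ℤ), ∀ x ∈ 𝒜 i, d x ∈ 𝒜 (i + 1)
  leibniz : ∀ (i : ℤ), ∀ x ∈ 𝒜 i, ∀ y : A, d (x * y) = d x * y + gsign i • (x * d y)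

/-- Every member of `a` is a cycle. -/
def IsCycleList (d : A →ₗ[k] A) (a : List A) : Prop :=
  ∀ x ∈ a, x ∈ LinearMap.ker d

/-- `a` and `b` are entrywise homologous lists of cycles. -/
def HomologyEquiv (d : A →ₗ[k] A) (a b : List A) : Prop :=
  List.Forall₂
    (fun x y => x ∈ LinearMap.ker d ∧ y ∈ LinearMap.ker d ∧ x - y ∈ LinearMap.range d) a b

/-- `a` is a list of homogeneous elements whose degrees are listed in `ds`. -/
def IsHomogeneousList (𝒜 : ℤ → Submodule k A) (ds : List ℤ) (a : List A) : Prop :=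
  List.Forall₂ (fun x i => x ∈ 𝒜 i) a ds

/-- `F : List A → A` encodes, at every arity `≤ N`, a `k`-multilinear map on homology
classes (evaluated on lists of representing cycles) with values in `A`. -/
structure EncodesFamily (d : A →ₗ[k] A) (F : List A → A) (N : ℕ) : Prop where
  congr : ∀ a b : List A, a.length ≤ N → HomologyEquiv d a b → F a = F b
  map_add : ∀ (pre : List A) (u v : A) (post : List A),
    pre.length + post.length + 1 ≤ N → IsCycleList d pre →
    u ∈ LinearMap.ker d → v ∈ LinearMap.ker d → IsCycleList d post →
    F (pre ++ (u + v) :: post) = F (pre ++ u :: post) + F (pre ++ v :: post)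
  map_smul : ∀ (pre : List A) (c : k) (u : A) (post : List A),
    pre.length + post.length + 1 ≤ N → IsCycleList d pre →
    u ∈ LinearMap.ker d → IsCycleList d post →
    F (pre ++ (c • u) :: post) = c • F (pre ++ u :: post)

/-- `M : List A → A` encodes, at every arity `≤ N`, a `k`-multilinear operation on
homology with values in homology: the value on representing cycles is a (canonically
chosen) representing cycle of the resulting class. -/
structure EncodesOps (d : A →ₗ[k] A) (M : List A → A) (N : ℕ)
    extends EncodesFamily d M N : Prop where
  mem_ker : ∀ a : List A, a.length ≤ N → IsCycleList d a → M a ∈ LinearMap.ker d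

/-- At arity one, `F` encodes a cycle-choosing map `f₁ : H → A`: it sends (the class
of) a cycle `u` to a cycle homologous to `u`. -/
structure IsCycleChoosing (d : A →ₗ[k] A) (F : List A → A) : Prop where
  mem_ker : ∀ u ∈ LinearMap.ker d, F [u] ∈ LinearMap.ker d
  sub_mem : ∀ u ∈ LinearMap.ker d, F [u] - u ∈ LinearMap.range d

/-- The operations `mₙ` encoded by `M` have degree `2 - n`, for `n ≤ N`. -/
def OpsHaveDegree (𝒜 : ℤ → Submodule k A) (M : List A → A) (N : ℕ) : Prop :=
  ∀ (ds : List ℤ) (a : List A), a.length ≤ N → IsHomogeneousList 𝒜 ds a →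
    M a ∈ 𝒜 (ds.sum + 2 - a.length)

/-- The maps `fₙ` encoded by `F` have degree `1 - n`, for `n ≤ N`. -/
def MapsHaveDegree (𝒜 : ℤ → Submodule k A) (F : List A → A) (N : ℕ) : Prop :=
  ∀ (ds : List ℤ) (a : List A), a.length ≤ N → IsHomogeneousList 𝒜 ds a →
    F a ∈ 𝒜 (ds.sum + 1 - a.length)

/-- `m₁ = 0` on homology: the value of `M` at arity one represents the zero class. -/
def MOneZero (d : A →ₗ[k] A) (M : List A → A) : Prop :=
  ∀ u ∈ LinearMap.ker d, M [u] ∈ LinearMap.range d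

/-- `m₂` is the multiplication induced on homology by the product of `A`. -/
def MTwoInduced (d : A →ₗ[k] A) (M : List A → A) : Prop :=
  ∀ u ∈ LinearMap.ker d, ∀ v ∈ LinearMap.ker d, M [u, v] - u * v ∈ LinearMap.range d

/-- Kadeishvili's obstruction
`Ψₙ(a₁,…,aₙ) = ∑_{s=1}^{n-1} (-1)^{ε₁(s)} f_s(a₁,…,a_s)·f_{n-s}(a_{s+1},…,aₙ)
  + ∑_{j=2}^{n-1} ∑_{t=0}^{n-j} (-1)^{ε₂(t,j)} f_{n-j+1}(a₁,…,a_t, m_j(a_{t+1},…,a_{t+j}),…,aₙ)`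
with `ε₁(s) = s + (n-s+1)(|a₁|+⋯+|a_s|)` and `ε₂(t,j) = t + j(n-t-j+|a₁|+⋯+|a_t|)`,
evaluated on a list `a` of representing cycles with degree list `ds`; `n = a.length`. -/
def Psi (F M : List A → A) (ds : List ℤ) (a : List A) : A :=
  (∑ s ∈ Finset.Ioo 0 a.length,
      gsign ((s : ℤ) + ((a.length : ℤ) - (s : ℤ) + 1) * (ds.take s).sum) •
        (F (a.take s) * F (a.drop s))) +
  ∑ j ∈ Finset.Icc 2 (a.length - 1), ∑ t ∈ Finset.Icc 0 (a.length - j),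
      gsign ((t : ℤ) + (j : ℤ) * ((a.length : ℤ) - (t : ℤ) - (j : ℤ) + (ds.take t).sum)) •
        F (a.take t ++ M ((a.drop t).take j) :: a.drop (t + j))

/-- The Stasheff sum `∑_{r+s+t=n} (-1)^{r+st} m_{r+1+t}(1^{⊗r} ⊗ m_s ⊗ 1^{⊗t})`,
evaluated (with the Koszul sign `(-1)^{s(|a₁|+⋯+|a_r|)}`) on a list `a` of
representing cycles with degree list `ds`. -/
def StasheffSum (M : List A → A) (ds : List ℤ) (a : List A) : A :=
  ∑ r ∈ Finset.range a.length, ∑ s ∈ Finset.Icc 1 (a.length - r),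
    gsign ((r : ℤ) + (s : ℤ) * ((a.length : ℤ) - (r : ℤ) - (s : ℤ)) +
        (s : ℤ) * (ds.take r).sum) •
      M (a.take r ++ M ((a.drop r).take s) :: a.drop (r + s))

/-- The Stasheff identity `Stₙ` holds on homology at every arity `n ≤ N`. -/
def SatisfiesStasheff (d : A →ₗ[k] A) (𝒜 : ℤ → Submodule k A) (M : List A → A)
    (N : ℕ) : Prop :=
  ∀ (ds : List ℤ) (a : List A), a.length ≤ N → IsCycleList d a →
    IsHomogeneousList 𝒜 ds a → StasheffSum M ds a ∈ LinearMap.range d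

/-- The `A_∞`-operations of the dg-algebra `A` itself: `m₁ = d`, `m₂` the product,
and `mₙ = 0` for `n ≥ 3`. -/
def dgOps (d : A →ₗ[k] A) : List A → A
  | [x] => d x
  | [x, y] => x * y
  | _ => 0

/-- The exponent `w = (q-1)(i₁-1) + (q-2)(i₂-1) + ⋯ + (i_{q-1}-1)` attached to a
composition with blocks `bs = [i₁, …, i_q]`. -/
def wExp (bs : List ℕ) : ℤ :=
  ∑ p ∈ Finset.range bs.length,
    ((bs.length : ℤ) - 1 - (p : ℤ)) * ((bs.getD p 0 : ℤ) - 1)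

/-- The Koszul sign exponent arising when evaluating `f_{i₁} ⊗ ⋯ ⊗ f_{i_q}` on
homogeneous elements whose degrees are grouped into blocks `dbs`:
`∑_p (1 - i_p)·(sum of the degrees in the blocks before block p)`. -/
def koszulExp (dbs : List (List ℤ)) : ℤ :=
  ∑ p ∈ Finset.range dbs.length,
    (1 - ((dbs.getD p []).length : ℤ)) * ((dbs.take p).map List.sum).sum

/-- Left-hand side `∑_{r+s+t=n} (-1)^{r+st} f_{r+1+t}(1^{⊗r} ⊗ m_s ⊗ 1^{⊗t})` of the
Stasheff morphism identity `Stᵐₙ`, with Koszul signs, on representing cycles. -/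
def MorphismLHS (F M : List A → A) (ds : List ℤ) (a : List A) : A :=
  ∑ r ∈ Finset.range a.length, ∑ s ∈ Finset.Icc 1 (a.length - r),
    gsign ((r : ℤ) + (s : ℤ) * ((a.length : ℤ) - (r : ℤ) - (s : ℤ)) +
        (s : ℤ) * (ds.take r).sum) •
      F (a.take r ++ M ((a.drop r).take s) :: a.drop (r + s))

/-- Right-hand side `∑_{i₁+⋯+i_q=n} (-1)^w m_q(f_{i₁} ⊗ ⋯ ⊗ f_{i_q})` of the Stasheff
morphism identity `Stᵐₙ`, with Koszul signs; here the `m_q` are the dg-operations of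
the target `A` (`m₁ = d`, `m₂` the product, `mₙ = 0` otherwise). -/
def MorphismRHS (d : A →ₗ[k] A) (F : List A → A) (ds : List ℤ) (a : List A) : A :=
  ∑ c : Composition a.length,
    gsign (wExp c.blocks + koszulExp (ds.splitWrtComposition c)) •
      dgOps d ((a.splitWrtComposition c).map F)

/-- The Stasheff morphism identity `Stᵐₙ` holds at every arity `n ≤ N`. -/
def SatisfiesStasheffMorph (d : A →ₗ[k] A) (𝒜 : ℤ → Submodule k A)
    (F M : List A → A) (N : ℕ) : Prop :=
  ∀ (ds : List ℤ) (a : List A), a.length ≤ N → IsCycleList d a →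
    IsHomogeneousList 𝒜 ds a → MorphismLHS F M ds a = MorphismRHS d F ds a

/-- The arity-`n` data was chosen according to the Kadeishvili algorithm (`n ≥ 3`):
`mₙ(a)` is the homology class of the cycle `Ψₙ(a)`, and `d fₙ(a) = Ψₙ(a) - f₁(mₙ(a))`. -/
def KadeishviliAt (d : A →ₗ[k] A) (𝒜 : ℤ → Submodule k A) (F M : List A → A)
    (n : ℕ) : Prop :=
  ∀ (ds : List ℤ) (a : List A), a.length = n → IsCycleList d a →
    IsHomogeneousList 𝒜 ds a →
      M a - Psi F M ds a ∈ LinearMap.range d ∧ d (F a) = Psi F M ds a - F [M a]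

/-- The arity-two map `f₂` was chosen according to the Kadeishvili algorithm:
`d f₂(a₁,a₂) = f₁(a₁)f₁(a₂) - f₁(a₁a₂)`. -/
def KadeishviliTwo (d : A →ₗ[k] A) (F : List A → A) : Prop :=
  ∀ u ∈ LinearMap.ker d, ∀ v ∈ LinearMap.ker d,
    d (F [u, v]) = F [u] * F [v] - F [u * v]

/-- `M` encodes `k[z]`-multilinear operations (up to arity `N`):
`mₙ(a₁,…,z·aᵢ,…,aₙ) = z·mₙ(a₁,…,aₙ)` on homology. -/
def OpsZLinear (d : A →ₗ[k] A) (z₀ : A) (M : List A → A) (N : ℕ) : Prop :=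
  ∀ (pre : List A) (u : A) (post : List A), pre.length + post.length + 1 ≤ N →
    IsCycleList d pre → u ∈ LinearMap.ker d → IsCycleList d post →
    M (pre ++ (z₀ * u) :: post) - z₀ * M (pre ++ u :: post) ∈ LinearMap.range d

/-- `F` encodes `k[z]`-multilinear maps (up to arity `N`):
`fₙ(a₁,…,z·aᵢ,…,aₙ) = f₁(z)·fₙ(a₁,…,aₙ)` in `A`. -/
def MapsZLinear (d : A →ₗ[k] A) (z₀ : A) (F : List A → A) (N : ℕ) : Prop :=
  ∀ (pre : List A) (u : A) (post : List A), pre.length + post.length + 1 ≤ N →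
    IsCycleList d pre → u ∈ LinearMap.ker d → IsCycleList d post →
    F (pre ++ (z₀ * u) :: post) = F [z₀] * F (pre ++ u :: post)

/-- `ζ = f₁(z)` commutes with all the values of `F` (up to arity `N`). -/
def ZetaCommutes (d : A →ₗ[k] A) (z₀ : A) (F : List A → A) (N : ℕ) : Prop :=
  ∀ a : List A, a.length ≤ N → IsCycleList d a → F [z₀] * F a = F a * F [z₀]

/-! ### Sums over deconcatenations of a list -/

section SplitSum

variable {α G : Type*} [AddCommGroup G]

/-- The sum of `φ x y` over all ways of writing `w = x ++ y`. -/
def splitSum (φ : List α → List α → G) (w : List α) : G :=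
  ∑ s ∈ Finset.range (w.length + 1), φ (w.take s) (w.drop s)

lemma splitSum_nil (φ : List α → List α → G) : splitSum φ [] = φ [] [] := by
  simp [splitSum]

lemma splitSum_cons (φ : List α → List α → G) (c : α) (w : List α) :
    splitSum φ (c :: w) = φ [] (c :: w) + splitSum (fun x y => φ (c :: x) y) w := by
  unfold splitSum
  rw [List.length_cons, Finset.sum_range_succ']
  simp [add_comm]

lemma splitSum_congr {φ ψ : List α → List α → G} {w : List α}
    (h : ∀ x y, x ++ y = w → φ x y = ψ x y) : splitSum φ w = splitSum ψ w :=
  Finset.sum_congr rfl fun s _ => h _ _ (List.take_append_drop s w)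

lemma splitSum_eq_zero {φ : List α → List α → G} {w : List α}
    (h : ∀ x y, x ++ y = w → φ x y = 0) : splitSum φ w = 0 :=
  Finset.sum_eq_zero fun s _ => h _ _ (List.take_append_drop s w)

lemma splitSum_add (φ ψ : List α → List α → G) (w : List α) :
    splitSum (fun x y => φ x y + ψ x y) w = splitSum φ w + splitSum ψ w :=
  Finset.sum_add_distrib

lemma splitSum_neg (φ : List α → List α → G) (w : List α) :
    splitSum (fun x y => -φ x y) w = -splitSum φ w :=
  Finset.sum_neg_distrib _

lemma splitSum_sub (φ ψ : List α → List α → G) (w : List α) :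
    splitSum (fun x y => φ x y - ψ x y) w = splitSum φ w - splitSum ψ w :=
  Finset.sum_sub_distrib _ _

lemma smul_splitSum (c : ℤ) (φ : List α → List α → G) (w : List α) :
    c • splitSum φ w = splitSum (fun x y => c • φ x y) w :=
  Finset.smul_sum

lemma map_splitSum {H E : Type*} [AddCommGroup H] [FunLike E G H] [AddMonoidHomClass E G H]
    (g : E) (φ : List α → List α → G) (w : List α) :
    g (splitSum φ w) = splitSum (fun x y => g (φ x y)) w :=
  map_sum g _ _

lemma splitSum_comm (φ : List α → List α → List α → List α → G) (v w : List α) :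
    splitSum (fun x y => splitSum (fun s t => φ x y s t) v) w =
      splitSum (fun s t => splitSum (fun x y => φ x y s t) w) v :=
  Finset.sum_comm

lemma splitSum_assoc (φ : List α → List α → List α → G) (w : List α) :
    splitSum (fun v z => splitSum (fun x y => φ x y z) v) w =
      splitSum (fun x v => splitSum (fun y z => φ x y z) v) w := by
  induction w generalizing φ with
  | nil => simp [splitSum_nil]
  | cons c w ih =>
    simp only [splitSum_cons, splitSum_nil, splitSum_add, ih]
    abel

lemma splitSum_append_cons (φ : List α → List α → G) (x : List α) (c : α) (z : List α) :
    splitSum φ (x ++ c :: z) = splitSum (fun u v => φ u (v ++ c :: z)) x +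
      splitSum (fun u v => φ (x ++ c :: u) v) z := by
  induction x generalizing φ with
  | nil => simp [splitSum_nil, splitSum_cons]
  | cons b x ih =>
    simp only [List.cons_append, splitSum_cons, ih]
    abel

/-- The sum of `φ x y z` over all ways of writing `w = x ++ y ++ z`. -/
def splitSum₃ (φ : List α → List α → List α → G) (w : List α) : G :=
  splitSum (fun x v => splitSum (fun y z => φ x y z) v) w

lemma splitSum₃_eq_sum (φ : List α → List α → List α → G) (w : List α) :
    splitSum₃ φ w = ∑ r ∈ Finset.range (w.length + 1),
      ∑ s ∈ Finset.range ((w.drop r).length + 1),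
        φ (w.take r) ((w.drop r).take s) ((w.drop r).drop s) := rfl

lemma splitSum₃_congr {φ ψ : List α → List α → List α → G} {w : List α}
    (h : ∀ x y z, x ++ (y ++ z) = w → φ x y z = ψ x y z) : splitSum₃ φ w = splitSum₃ ψ w :=
  splitSum_congr fun x _ hv => splitSum_congr fun y z hy => h x y z (by rw [hy, hv])

lemma splitSum₃_eq_zero {φ : List α → List α → List α → G} {w : List α}
    (h : ∀ x y z, x ++ (y ++ z) = w → φ x y z = 0) : splitSum₃ φ w = 0 :=
  splitSum_eq_zero fun x _ hv => splitSum_eq_zero fun y z hy => h x y z (by rw [hy, hv])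

lemma splitSum₃_add (φ ψ : List α → List α → List α → G) (w : List α) :
    splitSum₃ (fun x y z => φ x y z + ψ x y z) w = splitSum₃ φ w + splitSum₃ ψ w := by
  simp only [splitSum₃, splitSum_add]

lemma splitSum₃_neg (φ : List α → List α → List α → G) (w : List α) :
    splitSum₃ (fun x y z => -φ x y z) w = -splitSum₃ φ w := by
  simp only [splitSum₃, splitSum_neg]

lemma smul_splitSum₃ (c : ℤ) (φ : List α → List α → List α → G) (w : List α) :
    c • splitSum₃ φ w = splitSum₃ (fun x y z => c • φ x y z) w := by
  simp only [splitSum₃, smul_splitSum]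

lemma map_splitSum₃ {H E : Type*} [AddCommGroup H] [FunLike E G H] [AddMonoidHomClass E G H]
    (g : E) (φ : List α → List α → List α → G) (w : List α) :
    g (splitSum₃ φ w) = splitSum₃ (fun x y z => g (φ x y z)) w := by
  simp only [splitSum₃, map_splitSum]

lemma splitSum₃_append_cons (φ : List α → List α → List α → G) (x : List α) (c : α)
    (z : List α) :
    splitSum₃ φ (x ++ c :: z) = splitSum₃ (fun u v t => φ u v (t ++ c :: z)) x +
      splitSum (fun u v => splitSum (fun s t => φ u (v ++ c :: s) t) z) x +
      splitSum₃ (fun u v t => φ (x ++ c :: u) v t) z := by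
  simp only [splitSum₃, splitSum_append_cons, splitSum_add]

lemma splitSum₃_splitSum₃_left
    (φ : List α → List α → List α → List α → List α → G) (w : List α) :
    splitSum₃ (fun x y z => splitSum₃ (fun u v t => φ u v t y z) x) w =
      splitSum₃ (fun u v s => splitSum₃ (fun t y z => φ u v t y z) s) w := by
  simp only [splitSum₃]
  calc _ = splitSum (fun x w' => splitSum (fun u x' => splitSum (fun y z =>
            splitSum (fun v t => φ u v t y z) x') w') x) w :=
        splitSum_congr fun x w' _ => splitSum_comm _ _ _
    _ = _ := by
        rw [splitSum_assoc]
        refine splitSum_congr fun u w₁ _ => ?_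
        exact (splitSum_congr fun x w' _ => splitSum_comm _ _ _).trans
          (splitSum_assoc (fun v t w' => splitSum (fun y z => φ u v t y z) w') _)

lemma splitSum₃_splitSum_splitSum
    (φ : List α → List α → List α → List α → List α → G) (w : List α) :
    splitSum₃ (fun x y z => splitSum (fun p x' => splitSum (fun z' r =>
        φ p x' y z' r) z) x) w =
      splitSum₃ (fun p q r => splitSum₃ (fun x y z => φ p x y z r) q) w := by
  simp only [splitSum₃]
  calc _ = splitSum (fun x w' => splitSum (fun p x' => splitSum (fun y z =>
            splitSum (fun z' r => φ p x' y z' r) z) w') x) w :=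
        splitSum_congr fun x w' _ => splitSum_comm _ _ _
    _ = _ := by simp only [splitSum_assoc]

lemma splitSum₃_splitSum_left (φ : List α → List α → List α → List α → G) (w : List α) :
    splitSum₃ (fun x y z => splitSum (fun u v => φ u v y z) x) w =
      splitSum (fun u s => splitSum₃ (fun v y z => φ u v y z) s) w := by
  simp only [splitSum₃]
  calc _ = splitSum (fun x w' => splitSum (fun u v => splitSum (fun y z =>
            φ u v y z) w') x) w :=
        splitSum_congr fun x w' _ => splitSum_comm _ _ _
    _ = _ := by simp only [splitSum_assoc]

lemma splitSum₃_splitSum_right (φ : List α → List α → List α → List α → G) (w : List α) :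
    splitSum₃ (fun x y z => splitSum (fun s t => φ x y s t) z) w =
      splitSum (fun q t => splitSum₃ (fun x y s => φ x y s t) q) w := by
  simp only [splitSum₃, splitSum_assoc]

end SplitSum

/-! ### The bar-construction identity -/

section Bar

variable {α R : Type*} [Ring R]

/-- The sum of all signed insertions of one operation `μ` into the argument of `f`. -/
def insertionSum (ε : List α → ℤ) (μ : List α → α) (f : List α → R) (w : List α) : R :=
  splitSum₃ (fun x y z => ε x • f (x ++ μ y :: z)) w

/-- The sum of all signed products of two values of `f` along `w`. -/
def productSum (ε : List α → ℤ) (f : List α → R) (w : List α) : R :=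
  splitSum (fun x y => ε x • (f x * f y)) w

/-- The obstruction `Ψ` in suspended sign conventions. -/
def barPsi (ε : List α → ℤ) (μ : List α → α) (f : List α → R) (w : List α) : R :=
  insertionSum ε μ f w + productSum ε f w

variable {ε : List α → ℤ} (hε : ∀ x y, ε (x ++ y) = ε x * ε y) (hε2 : ∀ x, ε x * ε x = 1)
  {μ : List α → α} (hμ : ∀ y, ε [μ y] = -ε y) (f : List α → R)

include hε hε2 hμ

lemma insertionSum_insertionSum (w : List α) :
    splitSum₃ (fun x y z => ε x • insertionSum ε μ f (x ++ μ y :: z)) w =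
      splitSum₃ (fun p q r => splitSum₃ (fun x y z =>
        ε x • f (p ++ μ (x ++ μ y :: z) :: r)) q) w := by
  have hc : ∀ x y z : List α, ε (x ++ μ y :: z) = -(ε x * ε y * ε z) := fun x y z => by
    rw [List.append_cons, hε, hε, hμ]; ring
  simp only [insertionSum, splitSum₃_append_cons, smul_add, splitSum₃_add]
  have h1 : splitSum₃ (fun x y z => ε x • splitSum₃ (fun u v t =>
        ε u • f (u ++ μ v :: (t ++ μ y :: z))) x) w =
      splitSum₃ (fun x y z => splitSum₃ (fun u v t =>
        (ε v * ε t) • f (u ++ μ v :: (t ++ μ y :: z))) x) w := by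
    refine splitSum₃_congr fun x y z _ => ?_
    rw [smul_splitSum₃]
    refine splitSum₃_congr fun u v t h => ?_
    rw [← h, hε, hε, smul_smul]
    congr 1
    linear_combination (ε v * ε t) * hε2 u
  have h3 : splitSum₃ (fun x y z => ε x • splitSum₃ (fun u v t =>
        ε (x ++ μ y :: u) • f (x ++ μ y :: u ++ μ v :: t)) z) w =
      -splitSum₃ (fun x y z => splitSum₃ (fun u v t =>
        (ε y * ε u) • f (x ++ μ y :: (u ++ μ v :: t))) z) w := by
    rw [← splitSum₃_neg]
    refine splitSum₃_congr fun x y z _ => ?_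
    rw [smul_splitSum₃, ← splitSum₃_neg]
    refine splitSum₃_congr fun u v t h => ?_
    rw [hc, smul_smul, ← neg_smul, List.append_assoc, List.cons_append]
    congr 1
    linear_combination (-(ε y * ε u)) * hε2 x
  have h2 : splitSum₃ (fun x y z => ε x • splitSum (fun u v => splitSum (fun s t =>
        ε u • f (u ++ μ (v ++ μ y :: s) :: t)) z) x) w =
      splitSum₃ (fun x y z => splitSum (fun u v => splitSum (fun s t =>
        ε v • f (u ++ μ (v ++ μ y :: s) :: t)) z) x) w := by
    refine splitSum₃_congr fun x y z _ => ?_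
    rw [smul_splitSum]
    refine splitSum_congr fun u v h => ?_
    rw [smul_splitSum]
    refine splitSum_congr fun s t _ => ?_
    rw [← h, hε, smul_smul]
    congr 1
    linear_combination (ε v) * hε2 u
  rw [h1, h2, h3, splitSum₃_splitSum₃_left, splitSum₃_splitSum_splitSum]
  abel

lemma insertionSum_productSum (w : List α) :
    splitSum₃ (fun x y z => ε x • productSum ε f (x ++ μ y :: z)) w =
      splitSum (fun x y => f x * insertionSum ε μ f y) w -
      splitSum (fun x y => ε x • (insertionSum ε μ f x * f y)) w := by
  have hc : ∀ x y z : List α, ε (x ++ μ y :: z) = -(ε x * ε y * ε z) := fun x y z => by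
    rw [List.append_cons, hε, hε, hμ]; ring
  simp only [productSum, splitSum_append_cons, smul_add, splitSum₃_add]
  rw [sub_eq_add_neg]
  congr 1
  · calc _ = splitSum₃ (fun x y z => splitSum (fun u v =>
            ε v • (f u * f (v ++ μ y :: z))) x) w := by
          refine splitSum₃_congr fun x y z _ => ?_
          rw [smul_splitSum]
          refine splitSum_congr fun u v h => ?_
          rw [← h, hε, smul_smul]
          congr 1
          linear_combination (ε v) * hε2 u
      _ = _ := by
          rw [splitSum₃_splitSum_left]
          refine splitSum_congr fun x y _ => ?_
          rw [insertionSum, ← AddMonoidHom.coe_mulLeft, map_splitSum₃]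
          simp only [AddMonoidHom.coe_mulLeft, mul_smul_comm]
  · calc _ = splitSum₃ (fun x y z => splitSum (fun u v =>
            -((ε y * ε u) • (f (x ++ μ y :: u) * f v))) z) w := by
          refine splitSum₃_congr fun x y z _ => ?_
          rw [smul_splitSum]
          refine splitSum_congr fun u v h => ?_
          rw [hc, smul_smul, ← neg_smul]
          congr 1
          linear_combination (-(ε y * ε u)) * hε2 x
      _ = _ := by
          rw [splitSum₃_splitSum_right, ← splitSum_neg]
          refine splitSum_congr fun x y _ => ?_
          rw [insertionSum, ← AddMonoidHom.mulRight_apply, map_splitSum₃, smul_splitSum₃,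
            ← splitSum₃_neg]
          refine splitSum₃_congr fun p q r h => ?_
          rw [AddMonoidHom.mulRight_apply, smul_mul_assoc, smul_smul, ← h, hε, hε]
          congr 2
          linear_combination (-(ε q * ε r)) * hε2 p

omit hμ in
lemma productSum_productSum (w : List α) :
    splitSum (fun x y => ε x • (productSum ε f x * f y)) w =
      splitSum (fun x y => f x * productSum ε f y) w := by
  calc _ = splitSum (fun x z => splitSum (fun u v => ε v • (f u * f v * f z)) x) w := by
        refine splitSum_congr fun x y _ => ?_
        rw [productSum, ← AddMonoidHom.mulRight_apply, map_splitSum, smul_splitSum]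
        refine splitSum_congr fun p q h => ?_
        rw [AddMonoidHom.mulRight_apply, smul_mul_assoc, smul_smul, ← h, hε]
        congr 1
        linear_combination (ε q) * hε2 p
    _ = _ := by
        rw [splitSum_assoc]
        refine splitSum_congr fun x y _ => ?_
        rw [productSum, ← AddMonoidHom.coe_mulLeft, map_splitSum]
        simp only [AddMonoidHom.coe_mulLeft, mul_smul_comm, mul_assoc]

/-- Applying the bar differential to `Ψ` leaves only the nested insertions. -/
lemma barPsi_barPsi (w : List α) :
    splitSum₃ (fun x y z => ε x • barPsi ε μ f (x ++ μ y :: z)) w +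
      splitSum (fun x y => ε x • (barPsi ε μ f x * f y) - f x * barPsi ε μ f y) w =
      splitSum₃ (fun p q r => splitSum₃ (fun x y z =>
        ε x • f (p ++ μ (x ++ μ y :: z) :: r)) q) w := by
  simp only [barPsi, smul_add, add_mul, mul_add, splitSum₃_add, splitSum_add, splitSum_sub]
  rw [insertionSum_insertionSum hε hε2 hμ, insertionSum_productSum hε hε2 hμ,
    productSum_productSum hε hε2]
  abel

end Bar

/-! ### Signs -/

lemma gsign_add (a b : ℤ) : gsign (a + b) = gsign a * gsign b := by
  by_cases ha : Even a <;> by_cases hb : Even b <;> simp [gsign, Int.even_add, ha, hb]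

lemma gsign_mul_self (a : ℤ) : gsign a * gsign a = 1 := by
  by_cases ha : Even a <;> simp [gsign, ha]

lemma gsign_congr {a b : ℤ} (h : Even (a - b)) : gsign a = gsign b := by
  rw [Int.even_sub] at h
  simp [gsign, h]

lemma gsign_add_one (a : ℤ) : gsign (a + 1) = -gsign a := by
  rw [gsign_add]
  simp [gsign]

/-- The exponent `∑ (n - i)|aᵢ|` of the sign relating `f(a₁,…,aₙ)` to its suspension. -/
def twistExp : List ℤ → ℤ
  | [] => 0
  | c :: w => c * w.length + twistExp w

lemma twistExp_append (x y : List ℤ) :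
    twistExp (x ++ y) = twistExp x + twistExp y + y.length * x.sum := by
  induction x with
  | nil => simp [twistExp]
  | cons c x ih =>
    simp only [List.cons_append, twistExp, ih, List.length_append, List.sum_cons]
    push_cast
    ring

lemma gsign_insertion (x y z : List ℤ) :
    gsign (x.sum + x.length) * (gsign (twistExp (x ++ (y.sum + 2 - y.length) :: z)) *
      gsign (twistExp y)) = gsign (twistExp (x ++ (y ++ z))) *
      gsign (x.length + y.length * z.length + y.length * x.sum) := by
  simp only [← gsign_add]
  apply gsign_congr
  simp only [twistExp_append, twistExp, List.length_cons, List.length_append]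
  push_cast
  exact ⟨x.sum + z.length - z.length * y.length - y.length * x.sum, by ring⟩

lemma gsign_product (x y : List ℤ) :
    gsign (x.sum + x.length) * (gsign (twistExp x) * gsign (twistExp y)) =
      gsign (twistExp (x ++ y)) * gsign (x.length + (y.length + 1) * x.sum) := by
  simp only [← gsign_add]
  apply gsign_congr
  simp only [twistExp_append]
  exact ⟨-(y.length * x.sum), by ring⟩

/-! ### Multilinear families on homology -/

section Family

variable {d : A →ₗ[k] A} {F : List A → A} {N : ℕ}

lemma EncodesFamily.map_zsmul (hF : EncodesFamily d F N) (pre : List A) (c : ℤ) (u : A)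
    (post : List A) (hN : pre.length + post.length + 1 ≤ N) (hpre : IsCycleList d pre)
    (hu : u ∈ LinearMap.ker d) (hpost : IsCycleList d post) :
    F (pre ++ (c • u) :: post) = c • F (pre ++ u :: post) := by
  rw [← Int.cast_smul_eq_zsmul k c u, hF.map_smul pre _ u post hN hpre hu hpost,
    Int.cast_smul_eq_zsmul]

lemma HomologyEquiv.refl {a : List A} (ha : IsCycleList d a) : HomologyEquiv d a a :=
  List.forall₂_same.2 fun x hx => ⟨ha x hx, ha x hx, by simp⟩

lemma EncodesFamily.eq_zero (hF : EncodesFamily d F N) (hd : ∀ x, d (d x) = 0)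
    (pre : List A) (u : A)
    (post : List A) (hN : pre.length + post.length + 1 ≤ N) (hpre : IsCycleList d pre)
    (hu : u ∈ LinearMap.range d) (hpost : IsCycleList d post) :
    F (pre ++ u :: post) = 0 := by
  have hu' : u ∈ LinearMap.ker d := by
    obtain ⟨v, rfl⟩ := hu
    exact hd v
  have h0 := hF.map_zsmul pre 0 u post hN hpre hu' hpost
  rw [zero_smul, zero_smul] at h0
  rw [← h0]
  refine hF.congr _ _ (by simp; omega) (List.rel_append (HomologyEquiv.refl hpre) ?_)
  exact .cons ⟨hu', zero_mem _, by simpa using hu⟩ (HomologyEquiv.refl hpost)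

end Family

/-! ### Suspended operations on words of graded letters -/

section Words

/-- The suspended sign of a word of letters `(degree, element)`. -/
def barSign (w : List (ℤ × A)) : ℤ := gsign ((w.map Prod.fst).sum + w.length)

/-- The suspension of `F`, extended by zero outside the arities `1, …, N`. -/
def barMap (F : List A → A) (N : ℕ) (w : List (ℤ × A)) : A :=
  if 1 ≤ w.length ∧ w.length ≤ N then
    gsign (twistExp (w.map Prod.fst)) • F (w.map Prod.snd) else 0

/-- The suspension of `M`, extended by zero outside the arities `2, …, N`. -/
def barOp (M : List A → A) (N : ℕ) (w : List (ℤ × A)) : ℤ × A :=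
  ((w.map Prod.fst).sum + 2 - w.length,
    if 2 ≤ w.length ∧ w.length ≤ N then
      gsign (twistExp (w.map Prod.fst)) • M (w.map Prod.snd) else 0)

/-- Every letter of `w` is a homogeneous cycle of the stated degree. -/
def IsCycleWord (𝒜 : ℤ → Submodule k A) (d : A →ₗ[k] A) (w : List (ℤ × A)) : Prop :=
  ∀ c ∈ w, c.2 ∈ LinearMap.ker d ∧ c.2 ∈ 𝒜 c.1

omit [Ring A] in
lemma barSign_append (x y : List (ℤ × A)) : barSign (x ++ y) = barSign x * barSign y := by
  rw [barSign, barSign, barSign, ← gsign_add]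
  congr 1
  simp only [List.map_append, List.sum_append, List.length_append]
  push_cast
  ring

omit [Ring A] in
lemma barSign_mul_self (x : List (ℤ × A)) : barSign x * barSign x = 1 := gsign_mul_self _

lemma barSign_barOp (M : List A → A) (N : ℕ) (y : List (ℤ × A)) :
    barSign [barOp M N y] = -barSign y := by
  rw [barSign, barSign, ← gsign_add_one]
  apply gsign_congr
  simp only [barOp, List.map_cons, List.map_nil, List.sum_cons, List.sum_nil, List.length_cons,
    List.length_nil]
  push_cast
  exact ⟨1 - y.length, by ring⟩

lemma barMap_nil (F : List A → A) (N : ℕ) : barMap F N [] = 0 := by simp [barMap]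

lemma barMap_of_lt (F : List A → A) {N : ℕ} {w : List (ℤ × A)} (h : N < w.length) :
    barMap F N w = 0 := if_neg (by omega)

variable {𝒜 : ℤ → Submodule k A} {d : A →ₗ[k] A} {M F : List A → A} {N : ℕ}

lemma isCycleWord_append {x y : List (ℤ × A)} :
    IsCycleWord 𝒜 d (x ++ y) ↔ IsCycleWord 𝒜 d x ∧ IsCycleWord 𝒜 d y := by
  simp only [IsCycleWord, List.forall_mem_append]

lemma isCycleWord_cons {c : ℤ × A} {y : List (ℤ × A)} :
    IsCycleWord 𝒜 d (c :: y) ↔ (c.2 ∈ LinearMap.ker d ∧ c.2 ∈ 𝒜 c.1) ∧ IsCycleWord 𝒜 d y := by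
  simp only [IsCycleWord, List.mem_cons, forall_eq_or_imp]

lemma IsCycleWord.isCycleList {w : List (ℤ × A)} (h : IsCycleWord 𝒜 d w) :
    IsCycleList d (w.map Prod.snd) := by
  intro x hx
  obtain ⟨c, hc, rfl⟩ := List.mem_map.1 hx
  exact (h c hc).1

lemma IsCycleWord.isHomogeneousList {w : List (ℤ × A)} (h : IsCycleWord 𝒜 d w) :
    IsHomogeneousList 𝒜 (w.map Prod.fst) (w.map Prod.snd) := by
  rw [IsHomogeneousList, List.forall₂_map_left_iff, List.forall₂_map_right_iff,
    List.forall₂_same]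
  exact fun c hc => (h c hc).2

lemma barOp_mem (hM : EncodesOps d M N) (hMdeg : OpsHaveDegree 𝒜 M N) {y : List (ℤ × A)}
    (hy : IsCycleWord 𝒜 d y) :
    (barOp M N y).2 ∈ LinearMap.ker d ∧ (barOp M N y).2 ∈ 𝒜 (barOp M N y).1 := by
  unfold barOp
  split_ifs with h
  · refine ⟨zsmul_mem (hM.mem_ker _ (by simpa using h.2) hy.isCycleList) _, zsmul_mem ?_ _⟩
    have := hMdeg _ _ (by simpa using h.2) hy.isHomogeneousList
    simpa using this
  · exact ⟨zero_mem _, zero_mem _⟩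

lemma isCycleWord_insert (hM : EncodesOps d M N) (hMdeg : OpsHaveDegree 𝒜 M N)
    {x y z : List (ℤ × A)} (h : IsCycleWord 𝒜 d (x ++ (y ++ z))) :
    IsCycleWord 𝒜 d (x ++ barOp M N y :: z) := by
  rw [isCycleWord_append, isCycleWord_append] at h
  rw [isCycleWord_append, isCycleWord_cons]
  exact ⟨h.1, barOp_mem hM hMdeg h.2.1, h.2.2⟩

lemma barMap_eq_zero_of_mem_range (hF : EncodesFamily d F N) (hd : ∀ x, d (d x) = 0)
    {p r : List (ℤ × A)} (hp : IsCycleWord 𝒜 d p) (hr : IsCycleWord 𝒜 d r) (e : ℤ) {u : A}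
    (hu : u ∈ LinearMap.range d) : barMap F N (p ++ (e, u) :: r) = 0 := by
  unfold barMap
  split_ifs with h
  · rw [List.map_append (f := Prod.snd), List.map_cons (f := Prod.snd), hF.eq_zero hd _ _ _ _ hp.isCycleList hu
      hr.isCycleList, smul_zero]
    simp only [List.length_append, List.length_cons, List.length_map] at h ⊢
    omega
  · rfl

lemma barOp_eq_zero_of_mem_range (hM : EncodesFamily d M N) (hd : ∀ x, d (d x) = 0)
    {p r : List (ℤ × A)} (hp : IsCycleWord 𝒜 d p) (hr : IsCycleWord 𝒜 d r) (e : ℤ) {u : A}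
    (hu : u ∈ LinearMap.range d) : (barOp M N (p ++ (e, u) :: r)).2 = 0 := by
  unfold barOp
  simp only
  split_ifs with h
  · rw [List.map_append (f := Prod.snd), List.map_cons (f := Prod.snd), hM.eq_zero hd _ _ _ _ hp.isCycleList hu
      hr.isCycleList, smul_zero]
    simp only [List.length_append, List.length_cons, List.length_map] at h ⊢
    omega
  · rfl

/-- A word with a letter `0` has vanishing `Ψ`. -/
lemma barPsi_eq_zero (hM : EncodesFamily d M N) (hF : EncodesFamily d F N)
    (hd : ∀ x, d (d x) = 0) {w : List (ℤ × A)} (hw : IsCycleWord 𝒜 d w)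
    (h0 : ∃ c ∈ w, c.2 = 0) (hop : ∀ y, IsCycleWord 𝒜 d y →
      (barOp M N y).2 ∈ LinearMap.ker d ∧ (barOp M N y).2 ∈ 𝒜 (barOp M N y).1) :
    barPsi barSign (barOp M N) (barMap F N) w = 0 := by
  have hF0 : ∀ v : List (ℤ × A), IsCycleWord 𝒜 d v → (∃ c ∈ v, c.2 = 0) →
      barMap F N v = 0 := by
    rintro v hv ⟨⟨e, u⟩, hc, rfl⟩
    obtain ⟨p, r, rfl⟩ := List.append_of_mem hc
    rw [isCycleWord_append, isCycleWord_cons] at hv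
    exact barMap_eq_zero_of_mem_range hF hd hv.1 hv.2.2 e (zero_mem _)
  have hM0 : ∀ v : List (ℤ × A), IsCycleWord 𝒜 d v → (∃ c ∈ v, c.2 = 0) →
      (barOp M N v).2 = 0 := by
    rintro v hv ⟨⟨e, u⟩, hc, rfl⟩
    obtain ⟨p, r, rfl⟩ := List.append_of_mem hc
    rw [isCycleWord_append, isCycleWord_cons] at hv
    exact barOp_eq_zero_of_mem_range hM hd hv.1 hv.2.2 e (zero_mem _)
  obtain ⟨c, hc, hc0⟩ := h0
  have h1 : insertionSum barSign (barOp M N) (barMap F N) w = 0 := by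
    refine splitSum₃_eq_zero fun x y z h => ?_
    subst h
    have hw' := hw
    rw [isCycleWord_append, isCycleWord_append] at hw
    obtain ⟨hx, hy, hz⟩ := hw
    rw [hF0 _ (isCycleWord_append.2 ⟨hx, isCycleWord_cons.2 ⟨hop y hy, hz⟩⟩), smul_zero]
    rw [List.mem_append, List.mem_append] at hc
    rcases hc with hc | hc | hc
    · exact ⟨c, by simp [hc], hc0⟩
    · exact ⟨barOp M N y, by simp, hM0 y hy ⟨c, hc, hc0⟩⟩
    · exact ⟨c, by simp [hc], hc0⟩
  have h2 : productSum barSign (barMap F N) w = 0 := by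
    refine splitSum_eq_zero fun x y h => ?_
    subst h
    rw [isCycleWord_append] at hw
    rcases List.mem_append.1 hc with hc | hc
    · rw [hF0 x hw.1 ⟨c, hc, hc0⟩, zero_mul, smul_zero]
    · rw [hF0 y hw.2 ⟨c, hc, hc0⟩, mul_zero, smul_zero]
  rw [barPsi, h1, h2, add_zero]

lemma barMap_insertion (hM : EncodesOps d M N) (hF : EncodesFamily d F N)
    {x y z : List (ℤ × A)} (h : IsCycleWord 𝒜 d (x ++ (y ++ z))) (hy2 : 2 ≤ y.length)
    (hyN : y.length ≤ N) (hN : x.length + z.length + 1 ≤ N) :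
    barSign x • barMap F N (x ++ barOp M N y :: z) =
      gsign (twistExp ((x ++ (y ++ z)).map Prod.fst)) •
        gsign (x.length + y.length * z.length + y.length * (x.map Prod.fst).sum) •
          F (x.map Prod.snd ++ M (y.map Prod.snd) :: z.map Prod.snd) := by
  rw [isCycleWord_append, isCycleWord_append] at h
  obtain ⟨hx, hy, hz⟩ := h
  have h1 : (x ++ barOp M N y :: z).length ≤ N := by
    simp only [List.length_append, List.length_cons]; omega
  rw [barMap, if_pos ⟨by simp; omega, h1⟩, barOp, if_pos ⟨hy2, hyN⟩]
  simp only [List.map_append, List.map_cons]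
  rw [hF.map_zsmul _ _ _ _ (by simpa using hN) hx.isCycleList
    (hM.mem_ker _ (by simpa using hyN) hy.isCycleList) hz.isCycleList]
  simp only [smul_smul]
  congr 1
  have := gsign_insertion (x.map Prod.fst) (y.map Prod.fst) (z.map Prod.fst)
  simp only [List.length_map] at this
  rw [barSign, this]

lemma barMap_product (F : List A → A) {x y : List (ℤ × A)} (hx : 1 ≤ x.length)
    (hxN : x.length ≤ N) (hy : 1 ≤ y.length) (hyN : y.length ≤ N) :
    barSign x • (barMap F N x * barMap F N y) =
      gsign (twistExp ((x ++ y).map Prod.fst)) •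
        gsign (x.length + (y.length + 1) * (x.map Prod.fst).sum) •
          (F (x.map Prod.snd) * F (y.map Prod.snd)) := by
  rw [barMap, barMap, if_pos ⟨hx, hxN⟩, if_pos ⟨hy, hyN⟩, smul_mul_smul_comm, smul_smul,
    smul_smul, List.map_append]
  congr 1
  have := gsign_product (x.map Prod.fst) (y.map Prod.fst)
  simp only [List.length_map] at this
  rw [barSign, this]

lemma productSum_eq (F : List A → A) {w : List (ℤ × A)} (hN : w.length ≤ N + 1) :
    productSum barSign (barMap F N) w = gsign (twistExp (w.map Prod.fst)) •
      ∑ s ∈ Finset.Ioo 0 (w.map Prod.snd).length,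
        gsign ((s : ℤ) + (((w.map Prod.snd).length : ℤ) - (s : ℤ) + 1) *
          ((w.map Prod.fst).take s).sum) •
          (F ((w.map Prod.snd).take s) * F ((w.map Prod.snd).drop s)) := by
  rw [productSum, splitSum, Finset.smul_sum]
  symm
  refine Finset.sum_subset_zero_on_sdiff ?_ ?_ ?_
  · intro s
    simp only [List.length_map, Finset.mem_Ioo, Finset.mem_range]
    omega
  · intro s
    simp only [List.length_map, Finset.mem_Ioo, Finset.mem_range, Finset.mem_sdiff]
    intro hs
    obtain rfl | rfl : s = 0 ∨ s = w.length := by omega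
    · simp [barMap_nil]
    · simp [barMap_nil]
  · intro s
    simp only [List.length_map, Finset.mem_Ioo]
    intro hs
    rw [barMap_product F, List.take_append_drop, List.length_take, List.length_drop,
      min_eq_left hs.2.le, ← List.map_take, ← List.map_take, ← List.map_drop, Nat.cast_sub hs.2.le]
    all_goals simp only [List.length_take, List.length_drop]; omega

lemma barMap_insertion_take_drop (hM : EncodesOps d M N) (hF : EncodesFamily d F N)
    {w : List (ℤ × A)} (hw : IsCycleWord 𝒜 d w) {r s : ℕ} (hr : r + s ≤ w.length)
    (hs : 2 ≤ s) (hsN : s ≤ N) (hN : w.length - s + 1 ≤ N) :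
    barSign (w.take r) • barMap F N (w.take r ++ barOp M N ((w.drop r).take s) ::
        (w.drop r).drop s) =
      gsign (twistExp (w.map Prod.fst)) •
        gsign ((r : ℤ) + (s : ℤ) * (((w.map Prod.snd).length : ℤ) - (r : ℤ) - (s : ℤ)) +
          (s : ℤ) * ((w.map Prod.fst).take r).sum) •
        F ((w.map Prod.snd).take r ++ M (((w.map Prod.snd).drop r).take s) ::
          (w.map Prod.snd).drop (r + s)) := by
  have hw' : IsCycleWord 𝒜 d (w.take r ++ ((w.drop r).take s ++ (w.drop r).drop s)) := by
    simpa only [List.take_append_drop] using hw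
  have hl : (((w.drop r).drop s).length : ℤ) = (w.length : ℤ) - r - s := by
    simp only [List.length_drop]; omega
  rw [barMap_insertion hM hF hw', hl, List.take_append_drop, List.take_append_drop,
    List.length_take, List.length_take, List.length_drop, min_eq_left (by omega),
    min_eq_left (by omega), ← List.map_take, ← List.map_take, ← List.map_drop, ← List.map_drop,
    ← List.map_take, List.drop_drop, List.length_map]
  all_goals simp only [List.length_take, List.length_drop]; omega

lemma barMap_insertion_eq_zero (M : List A → A) (hF : EncodesFamily d F N)
    (hd : ∀ x, d (d x) = 0) {x y z : List (ℤ × A)} (h : IsCycleWord 𝒜 d (x ++ (y ++ z)))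
    (hy : ¬ (2 ≤ y.length ∧ y.length ≤ N)) : barMap F N (x ++ barOp M N y :: z) = 0 := by
  rw [isCycleWord_append, isCycleWord_append] at h
  rw [barOp, if_neg hy]
  exact barMap_eq_zero_of_mem_range hF hd h.1 h.2.2 _ (zero_mem _)

end Words

/-! ### The right-hand side of the morphism identity -/

section MorphismRHS

/-- The composition of `m` into the two blocks `s` and `m - s`. -/
def pairComposition (m s : ℕ) (h : s ∈ Finset.Ioo 0 m) : Composition m where
  blocks := [s, m - s]
  blocks_pos := by
    rw [Finset.mem_Ioo] at h
    intro i hi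
    simp only [List.mem_cons, List.not_mem_nil, or_false] at hi
    omega
  blocks_sum := by
    rw [Finset.mem_Ioo] at h
    simp only [List.sum_cons, List.sum_nil]
    omega

lemma morphismRHS_eq (d : A →ₗ[k] A) (F : List A → A) {ds : List ℤ} {a : List A}
    (hl : ds.length = a.length) (ha : 0 < a.length) :
    MorphismRHS d F ds a = d (F a) - ∑ s ∈ Finset.Ioo 0 a.length,
      gsign ((s : ℤ) + ((a.length : ℤ) - (s : ℤ) + 1) * (ds.take s).sum) •
        (F (a.take s) * F (a.drop s)) := by
  let e : Option {s // s ∈ Finset.Ioo 0 a.length} → Composition a.length := fun o =>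
    o.elim (Composition.single a.length ha) fun s => pairComposition a.length s.1 s.2
  have he : Function.Injective e := by
    rintro (_ | ⟨s, hs⟩) (_ | ⟨t, ht⟩) h
    · rfl
    · simpa [e, pairComposition, Composition.single] using congrArg Composition.blocks h
    · simpa [e, pairComposition, Composition.single] using congrArg Composition.blocks h
    · have := congrArg Composition.blocks h
      simp only [e, pairComposition, Option.elim, List.cons.injEq] at this
      simp [this.1]
  unfold MorphismRHS
  rw [← Fintype.sum_of_injective e he _ _ ?_ fun _ => rfl]
  · rw [Fintype.sum_option, sub_eq_add_neg, ← Finset.sum_neg_distrib,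
      ← Finset.sum_coe_sort (Finset.Ioo 0 a.length)]
    congr 1
    · simp [e, Composition.single, List.splitWrtComposition, List.splitWrtCompositionAux, wExp,
        koszulExp, dgOps, gsign]
    · refine Finset.sum_congr rfl fun ⟨s, hs⟩ _ => ?_
      rw [Finset.mem_Ioo] at hs
      have h1 : (a.drop s).take (a.length - s) = a.drop s := List.take_of_length_le (by simp)
      have h2 : (ds.drop s).take (a.length - s) = ds.drop s :=
        List.take_of_length_le (by simp [hl])
      simp only [e, Option.elim, pairComposition, List.splitWrtComposition,
        List.splitWrtCompositionAux, List.splitAt_eq, h1, h2, List.map_cons, List.map_nil, dgOps]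
      rw [← neg_smul, ← gsign_add_one]
      congr 1
      apply gsign_congr
      simp only [wExp, koszulExp, List.length_cons, List.length_nil, Finset.sum_range_succ,
        Finset.sum_range_zero, List.getD_cons_zero, List.getD_cons_succ, List.take_succ_cons,
        List.take_zero, List.map_cons, List.map_nil, List.sum_cons, List.sum_nil,
        List.length_drop, hl, Nat.cast_sub hs.2.le]
      push_cast
      exact ⟨-1 - (a.length - s) * (ds.take s).sum, by ring⟩
  · intro c hc
    have hlen : c.blocks.length = ((a.splitWrtComposition c).map F).length := by simp
    rcases hb : c.blocks with _ | ⟨s, _ | ⟨t, _ | ⟨u, l⟩⟩⟩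
    · have := c.blocks_sum
      simp only [hb, List.sum_nil] at this
      omega
    · refine absurd ⟨none, ?_⟩ hc
      have := c.blocks_sum
      ext1
      simp only [hb, List.sum_cons, List.sum_nil] at this
      simp [e, Composition.single, hb, ← this]
    · have hs := c.blocks_sum
      have hp : ∀ i ∈ c.blocks, 0 < i := fun _ => c.blocks_pos
      simp only [hb, List.sum_cons, List.sum_nil, List.mem_cons, List.not_mem_nil,
        or_false, forall_eq_or_imp, forall_eq] at hs hp
      refine absurd ⟨some ⟨s, by rw [Finset.mem_Ioo]; omega⟩, ?_⟩ hc
      ext1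
      simp only [e, Option.elim, pairComposition, hb]
      congr 2
      omega
    · rw [hb] at hlen
      rcases hq : (a.splitWrtComposition c).map F with _ | ⟨x, _ | ⟨y, _ | ⟨z, q⟩⟩⟩
      · simp [hq] at hlen
      · simp [hq] at hlen
      · simp [hq] at hlen
      · simp [dgOps]

end MorphismRHS

/-! ### The cycle property -/

section Cycle

variable {𝒜 : ℤ → Submodule k A} {d : A →ₗ[k] A} {M F : List A → A} {N : ℕ}

lemma insertionSum_eq_morphismLHS (hM : EncodesOps d M N) (hF : EncodesFamily d F N)
    (hd : ∀ x, d (d x) = 0) (hm1 : MOneZero d M) {w : List (ℤ × A)}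
    (hw : IsCycleWord 𝒜 d w) (hN : w.length ≤ N) :
    insertionSum barSign (barOp M N) (barMap F N) w =
      gsign (twistExp (w.map Prod.fst)) • MorphismLHS F M (w.map Prod.fst) (w.map Prod.snd) := by
  rw [insertionSum, splitSum₃_eq_sum, MorphismLHS, Finset.smul_sum, List.length_map, Finset.sum_range_succ]
  have hzero : ∀ r s, ¬ (2 ≤ ((w.drop r).take s).length ∧ ((w.drop r).take s).length ≤ N) →
      barMap F N (w.take r ++ barOp M N ((w.drop r).take s) :: (w.drop r).drop s) = 0 :=
    fun r s => barMap_insertion_eq_zero M hF hd (by simpa only [List.take_append_drop] using hw)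
  rw [Finset.sum_eq_zero (s := Finset.range ((w.drop w.length).length + 1)), add_zero]
  · refine Finset.sum_congr rfl fun r hr => ?_
    rw [Finset.mem_range] at hr
    rw [Finset.smul_sum]
    symm
    refine Finset.sum_subset_zero_on_sdiff ?_ ?_ ?_
    · intro s
      simp only [Finset.mem_Icc, List.length_drop, Finset.mem_range]
      omega
    · intro s
      simp only [Finset.mem_Icc, List.length_drop, Finset.mem_range, Finset.mem_sdiff]
      intro hs
      rw [hzero, smul_zero]
      simp only [List.length_take, List.length_drop]
      omega
    · intro s hs
      rw [Finset.mem_Icc] at hs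
      by_cases h2 : 2 ≤ s
      · rw [barMap_insertion_take_drop hM hF hw (by omega) h2 (by omega) (by omega),
          List.length_map]
      · obtain rfl : s = 1 := by omega
        rw [hzero, smul_zero]
        · have hcyc : ∀ v : List (ℤ × A), v ⊆ w → IsCycleList d (v.map Prod.snd) := fun v hv =>
            IsCycleWord.isCycleList (𝒜 := 𝒜) fun c hc => hw c (hv hc)
          have hu : M (((w.map Prod.snd).drop r).take 1) ∈ LinearMap.range d := by
            rw [List.drop_eq_getElem_cons (by simpa using hr), List.take_succ_cons,
              List.take_zero]
            exact hm1 _ (hcyc w (List.Subset.refl _) _ (List.getElem_mem _))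
          rw [hF.eq_zero hd _ _ _ _ _ hu, smul_zero, smul_zero]
          · rw [← List.map_drop]
            exact hcyc _ (List.drop_subset _ _)
          · simp only [List.length_take, List.length_drop, List.length_map]
            omega
          · rw [← List.map_take]
            exact hcyc _ (List.take_subset _ _)
        · simp only [List.length_take, List.length_drop]
          omega
  · intro s _
    rw [hzero, smul_zero]
    simp

lemma d_barMap (hM : EncodesOps d M N) (hF : EncodesFamily d F N) (hd : ∀ x, d (d x) = 0)
    (hm1 : MOneZero d M) (hStm : SatisfiesStasheffMorph d 𝒜 F M N) {w : List (ℤ × A)}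
    (hw : IsCycleWord 𝒜 d w) (hN : w.length ≤ N) :
    d (barMap F N w) = barPsi barSign (barOp M N) (barMap F N) w := by
  have hS := hStm _ _ (by simpa using hN) hw.isCycleList hw.isHomogeneousList
  rw [barPsi, insertionSum_eq_morphismLHS hM hF hd hm1 hw hN, productSum_eq F (by omega), hS,
    ← smul_add]
  rcases Nat.eq_zero_or_pos w.length with h0 | h0
  · obtain rfl := List.length_eq_zero_iff.1 h0
    have : MorphismRHS d F [] [] = 0 := by
      refine Finset.sum_eq_zero fun c _ => ?_
      have : c.blocks = [] := by simp
      simp [List.splitWrtComposition, this, List.splitWrtCompositionAux, dgOps]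
    simp [barMap_nil, this]
  · rw [morphismRHS_eq d F (by simp) (by simpa using h0), sub_add_cancel, barMap,
      if_pos ⟨h0, hN⟩, map_zsmul]

lemma barPsi_eq_psi (hM : EncodesOps d M N) (hF : EncodesFamily d F N)
    (hd : ∀ x, d (d x) = 0) {w : List (ℤ × A)} (hw : IsCycleWord 𝒜 d w)
    (hN : w.length = N + 1) :
    barPsi barSign (barOp M N) (barMap F N) w =
      gsign (twistExp (w.map Prod.fst)) • Psi F M (w.map Prod.fst) (w.map Prod.snd) := by
  rw [barPsi, productSum_eq F hN.le, Psi, add_comm, smul_add]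
  congr 1
  rw [insertionSum, splitSum₃_eq_sum]
  have hzero : ∀ r s, ¬ (2 ≤ ((w.drop r).take s).length ∧ ((w.drop r).take s).length ≤ N) →
      barMap F N (w.take r ++ barOp M N ((w.drop r).take s) :: (w.drop r).drop s) = 0 :=
    fun r s => barMap_insertion_eq_zero M hF hd (by simpa only [List.take_append_drop] using hw)
  conv_rhs => rw [Finset.sum_comm' (t' := Finset.range (w.length + 1))
    (s' := fun t => (Finset.Icc 2 N).filter (· ≤ w.length - t))
      (by
        intro j t
        simp only [Finset.mem_Icc, List.length_map, Finset.mem_range, Finset.mem_filter]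
        omega), Finset.smul_sum]
  refine Finset.sum_congr rfl fun r hr => ?_
  rw [Finset.mem_range] at hr
  rw [Finset.smul_sum]
  symm
  refine Finset.sum_subset_zero_on_sdiff ?_ ?_ ?_
  · intro s
    simp only [Finset.mem_filter, Finset.mem_Icc, List.length_drop, Finset.mem_range]
    omega
  · intro s
    simp only [Finset.mem_filter, Finset.mem_Icc, List.length_drop, Finset.mem_range,
      Finset.mem_sdiff]
    intro hs
    rw [hzero, smul_zero]
    simp only [List.length_take, List.length_drop]
    omega
  · intro s hs
    simp only [Finset.mem_filter, Finset.mem_Icc] at hs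
    rw [barMap_insertion_take_drop hM hF hw (by omega) hs.1.1 hs.1.2 (by omega), mul_sub,
      mul_sub]
    simp only [mul_add, mul_sub]
    congr 3
    ring

lemma sum_comp_of_mem {ι : Type*} (K : Submodule k A) {g : A → A} (h0 : g 0 = 0)
    (hadd : ∀ u ∈ K, ∀ v ∈ K, g (u + v) = g u + g v) (s : Finset ι) {φ : ι → A}
    (hφ : ∀ i ∈ s, φ i ∈ K) : g (∑ i ∈ s, φ i) = ∑ i ∈ s, g (φ i) := by
  classical
  induction s using Finset.induction_on with
  | empty => simpa using h0
  | insert i s hi ih =>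
    rw [Finset.sum_insert hi, Finset.sum_insert hi, hadd _ (hφ i (Finset.mem_insert_self i s)) _
      (sum_mem fun j hj => hφ j (Finset.mem_insert_of_mem hj)),
      ih fun j hj => hφ j (Finset.mem_insert_of_mem hj)]

/-- The left-hand side of the suspended Stasheff identity on `w`. -/
def barStasheff (M : List A → A) (N : ℕ) (w : List (ℤ × A)) : A :=
  splitSum₃ (fun x y z => barSign x • (barOp M N (x ++ barOp M N y :: z)).2) w

lemma barStasheff_mem_ker (hM : EncodesOps d M N) (hMdeg : OpsHaveDegree 𝒜 M N)
    {w : List (ℤ × A)} (hw : IsCycleWord 𝒜 d w) : barStasheff M N w ∈ LinearMap.ker d := by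
  rw [barStasheff, splitSum₃_eq_sum]
  refine sum_mem fun r _ => sum_mem fun s _ => zsmul_mem (barOp_mem hM hMdeg
    (isCycleWord_insert hM hMdeg ?_)).1 _
  simpa only [List.take_append_drop] using hw

lemma barMap_barStasheff (hM : EncodesOps d M N) (hMdeg : OpsHaveDegree 𝒜 M N)
    (hF : EncodesFamily d F N) (hd : ∀ x, d (d x) = 0) {p q r : List (ℤ × A)}
    (hw : IsCycleWord 𝒜 d (p ++ (q ++ r))) :
    splitSum₃ (fun x y z => barSign x • barMap F N (p ++ barOp M N (x ++ barOp M N y :: z) :: r))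
      q = barMap F N (p ++ ((q.map Prod.fst).sum + 3 - q.length, barStasheff M N q) :: r) := by
  rw [isCycleWord_append, isCycleWord_append] at hw
  obtain ⟨hp, hq, hr⟩ := hw
  set e : ℤ := (q.map Prod.fst).sum + 3 - q.length with he
  let g : A → A := fun u => barMap F N (p ++ (e, u) :: r)
  have hg0 : g 0 = 0 := barMap_eq_zero_of_mem_range hF hd hp hr e (zero_mem _)
  have hlen : ∀ u : A, (p ++ (e, u) :: r).length = p.length + r.length + 1 := fun u => by
    simp only [List.length_append, List.length_cons]; omega
  have hgadd : ∀ u ∈ LinearMap.ker d, ∀ v ∈ LinearMap.ker d, g (u + v) = g u + g v := by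
    intro u hu v hv
    simp only [g, barMap, hlen]
    split_ifs with h
    · simp only [List.map_append, List.map_cons]
      rw [hF.map_add _ _ _ _ (by simpa using h.2) hp.isCycleList hu hv hr.isCycleList, smul_add]
    · simp
  have hgsmul : ∀ (c : ℤ), ∀ u ∈ LinearMap.ker d, g (c • u) = c • g u := by
    intro c u hu
    simp only [g, barMap, hlen]
    split_ifs with h
    · simp only [List.map_append, List.map_cons]
      rw [hF.map_zsmul _ _ _ _ (by simpa using h.2) hp.isCycleList hu hr.isCycleList, smul_comm]
    · simp
  have hmem : ∀ x y z, x ++ (y ++ z) = q →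
      (barOp M N (x ++ barOp M N y :: z)).2 ∈ LinearMap.ker d := fun x y z h =>
    (barOp_mem hM hMdeg (isCycleWord_insert hM hMdeg (h ▸ hq))).1
  have hmem' : ∀ i j, (barOp M N (q.take i ++ barOp M N ((q.drop i).take j) ::
      (q.drop i).drop j)).2 ∈ LinearMap.ker d := fun i j =>
    hmem _ _ _ (by simp only [List.take_append_drop])
  change _ = g (barStasheff M N q)
  rw [barStasheff, splitSum₃_eq_sum, splitSum₃_eq_sum, sum_comp_of_mem _ hg0 hgadd]
  · refine Finset.sum_congr rfl fun i _ => ?_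
    rw [sum_comp_of_mem _ hg0 hgadd _ fun j _ => zsmul_mem (hmem' i j) _]
    refine Finset.sum_congr rfl fun j _ => ?_
    rw [hgsmul _ _ (hmem' i j)]
    have hdeg : ∀ x y z : List (ℤ × A), x ++ (y ++ z) = q →
        (barOp M N (x ++ barOp M N y :: z)).1 = e := by
      rintro x y z rfl
      simp only [he, barOp, List.map_append, List.map_cons, List.sum_append, List.sum_cons,
        List.length_append, List.length_cons]
      push_cast
      ring
    simp only [g]
    rw [← hdeg (q.take i) ((q.drop i).take j) ((q.drop i).drop j)
      (by simp only [List.take_append_drop])]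
  · exact fun i _ => sum_mem fun j _ => zsmul_mem (hmem' i j) _

lemma d_productSum [SetLike.GradedMonoid 𝒜] (hdg : IsDGAlgebra 𝒜 d)
    (hFdeg : MapsHaveDegree 𝒜 F N)
    {x y : List (ℤ × A)} (hx : IsCycleWord 𝒜 d x) (hN : x.length ≤ N) :
    d (barSign x • (barMap F N x * barMap F N y)) =
      barSign x • (d (barMap F N x) * barMap F N y) - barMap F N x * d (barMap F N y) := by
  have hmem : barMap F N x ∈ 𝒜 ((x.map Prod.fst).sum + 1 - x.length) := by
    unfold barMap
    split_ifs with h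
    · refine zsmul_mem ?_ _
      have := hFdeg _ _ (by simpa using hN) hx.isHomogeneousList
      simpa using this
    · exact zero_mem _
  have hsign : gsign ((x.map Prod.fst).sum + 1 - x.length) = -barSign x := by
    rw [barSign, ← gsign_add_one]
    exact gsign_congr ⟨-x.length, by ring⟩
  rw [map_zsmul, hdg.leibniz _ _ hmem, hsign, smul_add, smul_smul, mul_neg, barSign_mul_self]
  simp [sub_eq_add_neg]

lemma d_barPsi [SetLike.GradedMonoid 𝒜] (hdg : IsDGAlgebra 𝒜 d)
    (hM : EncodesOps d M N) (hF : EncodesFamily d F N)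
    (hm1 : MOneZero d M) (hMdeg : OpsHaveDegree 𝒜 M N) (hFdeg : MapsHaveDegree 𝒜 F N)
    (hStm : SatisfiesStasheffMorph d 𝒜 F M N) {w : List (ℤ × A)}
    (hw : IsCycleWord 𝒜 d w) (hN : w.length ≤ N + 1) :
    d (barPsi barSign (barOp M N) (barMap F N) w) =
      splitSum₃ (fun p (q : List (ℤ × A)) r => barMap F N
        (p ++ ((q.map Prod.fst).sum + 3 - q.length, barStasheff M N q) :: r)) w := by
  have hd := hdg.d_sq
  calc _ = splitSum₃ (fun x y z => barSign x •
            barPsi barSign (barOp M N) (barMap F N) (x ++ barOp M N y :: z)) w +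
          splitSum (fun x y => barSign x •
            (barPsi barSign (barOp M N) (barMap F N) x * barMap F N y) -
            barMap F N x * barPsi barSign (barOp M N) (barMap F N) y) w := by
        rw [barPsi, map_add, insertionSum, productSum, map_splitSum₃, map_splitSum]
        congr 1
        · refine splitSum₃_congr fun x y z h => ?_
          subst h
          rw [map_zsmul]
          congr 1
          have hins := isCycleWord_insert hM hMdeg hw
          by_cases hy : 2 ≤ y.length ∧ y.length ≤ N
          · apply d_barMap hM hF hd hm1 hStm hins
            simp only [List.length_append, List.length_cons] at hN ⊢
            omega
          · rw [barMap_insertion_eq_zero M hF hd hw hy, map_zero,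
              barPsi_eq_zero hM.toEncodesFamily hF hd hins
                ⟨barOp M N y, by simp, by rw [barOp, if_neg hy]⟩ fun y hy => barOp_mem hM hMdeg hy]
        · refine splitSum_congr fun x y h => ?_
          subst h
          rw [isCycleWord_append] at hw
          rw [List.length_append] at hN
          by_cases hx : x.length ≤ N
          · by_cases hy : y.length ≤ N
            · rw [d_productSum hdg hFdeg hw.1 hx, d_barMap hM hF hd hm1 hStm hw.1 hx,
                d_barMap hM hF hd hm1 hStm hw.2 hy]
            · have : x = [] := List.length_eq_zero_iff.1 (by omega)
              rw [this, barMap_nil, barMap_of_lt F (by omega)]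
              simp
          · have : y = [] := List.length_eq_zero_iff.1 (by omega)
            rw [this, barMap_nil, barMap_of_lt F (by omega)]
            simp
    _ = _ := by
        rw [barPsi_barPsi barSign_append barSign_mul_self (barSign_barOp M N)]
        refine splitSum₃_congr fun p q r h => ?_
        exact barMap_barStasheff hM hMdeg hF hd (h ▸ hw)

lemma splitSum₃_eq_single {α G : Type*} [AddCommGroup G] {φ : List α → List α → List α → G}
    {w : List α} (h : ∀ x y z, x ++ (y ++ z) = w → y.length < w.length → φ x y z = 0) :
    splitSum₃ φ w = φ [] w [] := by
  rw [splitSum₃, splitSum, Finset.sum_eq_single 0]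
  · rw [splitSum, Finset.sum_eq_single w.length]
    · simp
    · intro s hs hsw
      refine h _ _ _ (by simp) ?_
      simp only [List.drop_zero, Finset.mem_range, List.length_take] at hs ⊢
      omega
    · simp
  · intro r hr hr0
    rw [Finset.mem_range] at hr
    refine splitSum_eq_zero fun y z hyz => h _ _ _ (by rw [hyz, List.take_append_drop]) ?_
    have := congrArg List.length hyz
    simp only [List.length_append, List.length_drop] at this
    omega
  · simp

lemma barStasheff_mem_range_and_d_barPsi [SetLike.GradedMonoid 𝒜]
    (hdg : IsDGAlgebra 𝒜 d) (hN1 : 1 ≤ N)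
    (hM : EncodesOps d M N) (hF : EncodesFamily d F N) (hf1 : IsCycleChoosing d F)
    (hm1 : MOneZero d M) (hMdeg : OpsHaveDegree 𝒜 M N) (hFdeg : MapsHaveDegree 𝒜 F N)
    (hStm : SatisfiesStasheffMorph d 𝒜 F M N) {w : List (ℤ × A)}
    (hw : IsCycleWord 𝒜 d w) (hN : w.length ≤ N + 1) :
    barStasheff M N w ∈ LinearMap.range d ∧
      d (barPsi barSign (barOp M N) (barMap F N) w) = 0 := by
  induction hm : w.length using Nat.strong_induction_on generalizing w with
  | _ m ih =>
    subst hm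
    have key := d_barPsi hdg hM hF hm1 hMdeg hFdeg hStm hw hN
    rw [splitSum₃_eq_single] at key
    · have hF1 : barMap F N ([] ++ ((w.map Prod.fst).sum + 3 - w.length, barStasheff M N w) ::
          []) = F [barStasheff M N w] := by
        simp [barMap, hN1, twistExp, gsign]
      have hker := barStasheff_mem_ker hM hMdeg hw
      have hr : barStasheff M N w ∈ LinearMap.range d := by
        have h1 := hf1.sub_mem _ hker
        have h2 : F [barStasheff M N w] ∈ LinearMap.range d := ⟨_, key.trans hF1⟩
        simpa using sub_mem h2 h1
      refine ⟨hr, ?_⟩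
      rw [key]
      exact barMap_eq_zero_of_mem_range (𝒜 := 𝒜) (p := []) (r := []) hF hdg.d_sq
        (by simp [IsCycleWord]) (by simp [IsCycleWord]) _ hr
    · intro x y z h hlt
      have hw' := hw
      rw [← h, isCycleWord_append, isCycleWord_append] at hw'
      exact barMap_eq_zero_of_mem_range hF hdg.d_sq hw'.1 hw'.2.2 _
        (ih _ hlt hw'.2.1 (by omega) rfl).1

end Cycle

/-- Given an `A_{n-1}`-fragment `(m_k)_{k<n}` on `H_*(A)` (with
`m₁ = 0`, `m₂` induced) and a morphism fragment `(f_k)_{k<n}` into `A` (with `f₁`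
cycle-choosing) satisfying the Stasheff identities `St_k` and `Stᵐ_k` for `k ≤ n-1`,
the element `Ψₙ(a₁,…,aₙ) ∈ A` is a cycle for all homogeneous classes `a₁,…,aₙ`. -/
theorem stmt2 (𝒜 : ℤ → Submodule k A) [SetLike.GradedMonoid 𝒜]
    [DirectSum.Decomposition 𝒜]
    (d : A →ₗ[k] A) (hdg : IsDGAlgebra 𝒜 d) (n : ℕ) (hn : 3 ≤ n)
    (M F : List A → A)
    (hM : EncodesOps d M (n - 1)) (hF : EncodesFamily d F (n - 1))
    (hf1 : IsCycleChoosing d F)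
    (hm1 : MOneZero d M) (hm2 : MTwoInduced d M)
    (hMdeg : OpsHaveDegree 𝒜 M (n - 1)) (hFdeg : MapsHaveDegree 𝒜 F (n - 1))
    (hSt : SatisfiesStasheff d 𝒜 M (n - 1))
    (hStm : SatisfiesStasheffMorph d 𝒜 F M (n - 1)) :
    ∀ (ds : List ℤ) (a : List A), a.length = n → IsCycleList d a →
      IsHomogeneousList 𝒜 ds a → d (Psi F M ds a) = 0 := by
  intro ds a ha hcyc hhom
  have hlen : ds.length = a.length := hhom.length_eq.symm
  obtain ⟨N, rfl⟩ : ∃ N, n = N + 1 := ⟨n - 1, by omega⟩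
  rw [Nat.add_sub_cancel] at *
  have hfst : (ds.zip a).map Prod.fst = ds := List.map_fst_zip hlen.le
  have hsnd : (ds.zip a).map Prod.snd = a := List.map_snd_zip hlen.ge
  have hw : IsCycleWord 𝒜 d (ds.zip a) := by
    rintro ⟨e, u⟩ hc
    exact ⟨hcyc u (List.of_mem_zip hc).2,
      (List.forall₂_iff_zip.1 hhom.flip).2 hc⟩
  have hwN : (ds.zip a).length = N + 1 := by rw [List.length_zip, hlen, min_self, ha]
  have h := (barStasheff_mem_range_and_d_barPsi hdg (by omega) hM hF hf1 hm1 hMdeg hFdeg hStm hw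
    hwN.le).2
  rw [barPsi_eq_psi hM hF hdg.d_sq hw hwN, hfst, hsnd, map_zsmul] at h
  have h2 := congrArg (gsign (twistExp ds) • ·) h
  simpa only [smul_smul, gsign_mul_self, one_smul, smul_zero] using h2
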